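/- Let A be a rectangular region with boundary vertices v₁,…,v_L, and for each L-tuple g⃗ = (g₁,…,g_L) ∈ G^L define |φ_A(g⃗)⟩ ∝ Π_{i=1}^L A^A_{v_i}(g_i) P_A |1⃗⟩_A (normalized), where |1⃗⟩_A is the group-basis state on A with identity on every edge, P_A is the product of the projectors A_v over interior vertices of A, and A^A_{v}(g) is the boundary gauge transformation at v restricted to edges in A. Then for g⃗, h⃗ ∈ G^L: |φ_A(g⃗)⟩ = |φ_A(h⃗)⟩ if g⃗ = h⃗·a for some a ∈ G (i.e. g_i = h_i a for all i), and ⟨φ_A(h⃗)|φ_A(g⃗)⟩ = 0 otherwise. The analogous equality/orthogonality statements hold for the states |φ_{Ā}(g⃗)⟩ on the complement. Consequently the reduced density matrix of the trivial ground state |ψ₀⟩ ∝ Π_v A_v|1⃗⟩ is Tr_{Ā}|ψ₀⟩⟨ψ₀| = (1/|G|^{L−1}) Σ_{g₁,…,g_{L−1}∈G, g_L = 1} |φ_A(g⃗)⟩⟨φ_A(g⃗)|. -/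

import Mathlib

/-!
Kitaev's quantum double model, formalized on the concrete `L × L` periodic square
lattice on the torus (the setting of Bravyi–Hastings–Michalakis TQO conditions used
in the paper).  Vertices are `ZMod L × ZMod L`; an oriented edge is a pair
`(v, d)` of its base vertex `v` and a direction `d : Bool` (`false` = rightward,
`true` = upward).  Each edge carries `ℂ[G]`, so the total Hilbert space is
`(Edge L → G) → ℂ` with the "group basis" given by delta functions.
"Contained in a contractible subregion" is rendered as the rectangle having side
lengths `< L`, i.e. not wrapping around the torus.
-/

open scoped BigOperators Classical

noncomputable section

namespace QDM

/-- Vertices of the `L × L` periodic square lattice on the torus. -/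
abbrev Vtx (L : ℕ) := ZMod L × ZMod L

/-- Oriented edges: base vertex together with a direction
(`false` = rightward, `true` = upward). -/
abbrev Edge (L : ℕ) := (ZMod L × ZMod L) × Bool

/-- Source vertex of an edge. -/
def src {L : ℕ} (e : Edge L) : Vtx L := e.1

/-- Target vertex of an edge. -/
def tgt {L : ℕ} (e : Edge L) : Vtx L := if e.2 then e.1 + (0, 1) else e.1 + (1, 0)

/-- A step of a path: an edge together with a direction of traversal
(`true` = along the orientation of the edge, `false` = against it). -/
abbrev Step (L : ℕ) := Edge L × Bool

/-- Initial vertex of a step. -/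
def stepStart {L : ℕ} (s : Step L) : Vtx L := if s.2 then src s.1 else tgt s.1

/-- Final vertex of a step. -/
def stepEnd {L : ℕ} (s : Step L) : Vtx L := if s.2 then tgt s.1 else src s.1

/-- A (nonempty) closed loop: consecutive steps are linked and the last step ends
where the first begins. -/
def IsLoop {L : ℕ} (γ : List (Step L)) : Prop :=
  γ ≠ [] ∧ γ.Chain' (fun a b => stepEnd a = stepStart b) ∧
    ∀ a ∈ γ.head?, ∀ b ∈ γ.getLast?, stepEnd b = stepStart a

/-- A (possibly empty) closed loop based at `v₀`. -/
def IsLoopAt {L : ℕ} (v₀ : Vtx L) (γ : List (Step L)) : Prop :=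
  γ.Chain' (fun a b => stepEnd a = stepStart b) ∧
    (∀ a ∈ γ.head?, stepStart a = v₀) ∧ ∀ b ∈ γ.getLast?, stepEnd b = v₀

/-- A classical field configuration: one group element per edge.  The group-basis
state `|g⟩` of the paper corresponds to the delta function `deltaF g`. -/
abbrev Config (G : Type) (L : ℕ) := Edge L → G

/-- Holonomy of a configuration along a path: the ordered product of the edge
elements, inverting the elements on edges traversed against their orientation. -/
def hol {G : Type} [Group G] {L : ℕ} (x : Config G L) (γ : List (Step L)) : G :=
  (γ.map fun s => if s.2 then x s.1 else (x s.1)⁻¹).prod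

/-- The counterclockwise boundary loop of the plaquette whose lower-left corner
is `p`. -/
def plaqBoundary {L : ℕ} (p : Vtx L) : List (Step L) :=
  [((p, false), true), ((p + (1, 0), true), true),
   ((p + (0, 1), false), false), ((p, true), false)]

/-- Action on configurations of the local gauge transformation `A_v(h)`:
left multiplication by `h` on edges oriented away from `v`, right multiplication
by `h⁻¹` on edges oriented towards `v`. -/
def gaugeOne {G : Type} [Group G] {L : ℕ} (v : Vtx L) (h : G) (x : Config G L) :
    Config G L :=
  fun e => (if src e = v then h else 1) * x e * (if tgt e = v then h⁻¹ else 1)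

/-- Action on configurations of the product of the gauge transformations
`A_v(f v)` over all vertices `v`. -/
def gaugeAll {G : Type} [Group G] {L : ℕ} (f : Vtx L → G) (x : Config G L) :
    Config G L :=
  fun e => f (src e) * x e * (f (tgt e))⁻¹

/-! ### Hilbert space and operators -/

/-- The total Hilbert space `⊗_{e ∈ E} ℂ[G]`, realized as functions on the set of
group-basis labels. -/
abbrev H (G : Type) (L : ℕ) := Config G L → ℂ

/-- The standard inner product (antilinear in the first slot) on a finite
function space. -/
def finner {α : Type} [Fintype α] (ψ φ : α → ℂ) : ℂ :=
  ∑ x : α, (starRingEnd ℂ) (ψ x) * φ x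

/-- The basis state `|y⟩` as a delta function. -/
def deltaF {α : Type} (y : α) : α → ℂ := fun x => if x = y then 1 else 0

/-- Diagonal (in the given basis) operator with diagonal entries `c`. -/
def diagOpF {α : Type} (c : α → ℂ) : (α → ℂ) →ₗ[ℂ] (α → ℂ) where
  toFun ψ := fun x => c x * ψ x
  map_add' ψ φ := by funext x; simp [mul_add]
  map_smul' r ψ := by
    funext x
    simp only [Pi.smul_apply, smul_eq_mul, RingHom.id_apply]
    ring

/-- The adjoint of an operator with respect to the standard inner product. -/
noncomputable def adjOp {α : Type} [Fintype α] (O : (α → ℂ) →ₗ[ℂ] (α → ℂ)) :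
    (α → ℂ) →ₗ[ℂ] (α → ℂ) :=
  Matrix.toLin' (Matrix.conjTranspose (LinearMap.toMatrix' O))

/-- `P` is the orthogonal projector onto the subspace `W` (with respect to the
standard inner product): idempotent, self-adjoint, with range `W`. -/
def IsOrthProjOnto {α : Type} [Fintype α] (P : (α → ℂ) →ₗ[ℂ] (α → ℂ))
    (W : Submodule ℂ (α → ℂ)) : Prop :=
  P ∘ₗ P = P ∧ LinearMap.range P = W ∧ ∀ ψ φ, finner (P ψ) φ = finner ψ (P φ)

/-- The gauge transformation operator `A_v(h)` (a permutation of the group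
basis). -/
def Avg (G : Type) [Group G] (L : ℕ) (v : Vtx L) (h : G) : H G L →ₗ[ℂ] H G L :=
  LinearMap.funLeft ℂ ℂ (gaugeOne v h⁻¹)

/-- The vertex projector `A_v = (1/|G|) ∑_h A_v(h)`. -/
noncomputable def Av (G : Type) [Group G] [Fintype G] (L : ℕ) (v : Vtx L) :
    H G L →ₗ[ℂ] H G L :=
  (Fintype.card G : ℂ)⁻¹ • ∑ h : G, Avg G L v h

/-- The plaquette projector `B_p`, projecting onto group-basis states whose
holonomy counterclockwise around the plaquette `p` is trivial. -/
def Bp (G : Type) [Group G] (L : ℕ) (p : Vtx L) : H G L →ₗ[ℂ] H G L :=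
  diagOpF fun x => if hol x (plaqBoundary p) = 1 then 1 else 0

/-- The ground space `V_gs` of Kitaev's quantum double model:
common fixed space of all `A_v` and all `B_p`. -/
def groundSpace (G : Type) [Group G] [Fintype G] (L : ℕ) : Submodule ℂ (H G L) :=
  (⨅ v : Vtx L, LinearMap.ker (Av G L v - LinearMap.id)) ⊓
    ⨅ p : Vtx L, LinearMap.ker (Bp G L p - LinearMap.id)

/-- The gauge-invariant (physical) subspace: common fixed space of all `A_v`. -/
def Hgauge (G : Type) [Group G] [Fintype G] (L : ℕ) : Submodule ℂ (H G L) :=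
  ⨅ v : Vtx L, LinearMap.ker (Av G L v - LinearMap.id)

/-! ### Rectangular sublattices -/

/-- The edges of the `w × h` rectangular sublattice with lower-left corner `c`
(including the edges on its boundary). -/
def rectEdges (L : ℕ) (c : Vtx L) (w h : ℕ) : Set (Edge L) :=
  { e | ∃ i j : ℕ, e.1 = c + ((i : ZMod L), (j : ZMod L)) ∧
      if e.2 then i ≤ w ∧ j < h else i < w ∧ j ≤ h }

/-- The vertices of the rectangular sublattice. -/
def rectVtx (L : ℕ) (c : Vtx L) (w h : ℕ) : Set (Vtx L) :=
  { v | ∃ i j : ℕ, i ≤ w ∧ j ≤ h ∧ v = c + ((i : ZMod L), (j : ZMod L)) }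

/-- The interior vertices of the rectangular sublattice. -/
def rectIntVtx (L : ℕ) (c : Vtx L) (w h : ℕ) : Set (Vtx L) :=
  { v | ∃ i j : ℕ, 0 < i ∧ i < w ∧ 0 < j ∧ j < h ∧
      v = c + ((i : ZMod L), (j : ZMod L)) }

/-- The boundary vertices of the rectangular sublattice. -/
def rectBdryVtx (L : ℕ) (c : Vtx L) (w h : ℕ) : Set (Vtx L) :=
  { v | ∃ i j : ℕ, i ≤ w ∧ j ≤ h ∧ (i = 0 ∨ i = w ∨ j = 0 ∨ j = h) ∧
      v = c + ((i : ZMod L), (j : ZMod L)) }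

/-- The plaquettes of the rectangular sublattice (labelled by their lower-left
corners). -/
def rectPlaqs (L : ℕ) (c : Vtx L) (w h : ℕ) : Set (Vtx L) :=
  { p | ∃ i j : ℕ, i < w ∧ j < h ∧ p = c + ((i : ZMod L), (j : ZMod L)) }

/-- The boundary edges of the rectangular sublattice. -/
def rectBdryEdges (L : ℕ) (c : Vtx L) (w h : ℕ) : Set (Edge L) :=
  { e | ∃ i j : ℕ, e.1 = c + ((i : ZMod L), (j : ZMod L)) ∧
      if e.2 then (i = 0 ∨ i = w) ∧ j < h else i < w ∧ (j = 0 ∨ j = h) }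

/-! ### Reduced states and local operators -/

/-- Combine a configuration on the edges in `A` with one on the complementary
edges. -/
def merge {S : Type} {L : ℕ} (A : Set (Edge L)) (a : {e : Edge L // e ∈ A} → S)
    (b : {e : Edge L // e ∉ A} → S) : Edge L → S :=
  fun e => if h : e ∈ A then a ⟨e, h⟩ else b ⟨e, h⟩

/-- The reduced density matrix `Tr_{Ā} |ψ⟩⟨ψ|` of a state `ψ` on the edges in
`A`. -/
noncomputable def rho {S : Type} [Fintype S] {L : ℕ} [NeZero L] (A : Set (Edge L))
    (ψ : (Edge L → S) → ℂ) :
    Matrix ({e : Edge L // e ∈ A} → S) ({e : Edge L // e ∈ A} → S) ℂ :=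
  Matrix.of fun a a' => ∑ b : {e : Edge L // e ∉ A} → S,
    ψ (merge A a b) * (starRingEnd ℂ) (ψ (merge A a' b))

/-- The partial trace over the complement of `A` of an operator. -/
noncomputable def ptraceOp {S : Type} [Fintype S] {L : ℕ} [NeZero L]
    (A : Set (Edge L)) (O : ((Edge L → S) → ℂ) →ₗ[ℂ] ((Edge L → S) → ℂ)) :
    Matrix ({e : Edge L // e ∈ A} → S) ({e : Edge L // e ∈ A} → S) ℂ :=
  Matrix.of fun a a' => ∑ b : {e : Edge L // e ∉ A} → S,
    O (deltaF (merge A a' b)) (merge A a b)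

/-- An operator is supported on the edges in `A` if its matrix in the product
basis has the form `M ⊗ 𝟙`. -/
def SupportedOn {S : Type} {L : ℕ} (A : Set (Edge L))
    (O : ((Edge L → S) → ℂ) →ₗ[ℂ] ((Edge L → S) → ℂ)) : Prop :=
  ∃ M : Matrix ({e : Edge L // e ∈ A} → S) ({e : Edge L // e ∈ A} → S) ℂ,
    ∀ (a a' : {e : Edge L // e ∈ A} → S) (b b' : {e : Edge L // e ∉ A} → S),
      O (deltaF (merge A a' b')) (merge A a b) = if b = b' then M a a' else 0

end QDM

namespace QDM

/-- Extend a function defined on a set of vertices by `1` elsewhere. -/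
def extendV {G : Type} [Group G] {L : ℕ} (I : Set (Vtx L))
    (f : {v : Vtx L // v ∈ I} → G) : Vtx L → G :=
  fun v => if hv : v ∈ I then f ⟨v, hv⟩ else 1

/-- The action on configurations of the edges in `A` of the gauge
transformations `A_v(f v)` (restricted to the edges in `A`). -/
def gaugeAllOn {G : Type} [Group G] {L : ℕ} (A : Set (Edge L)) (f : Vtx L → G)
    (a : {e : Edge L // e ∈ A} → G) : {e : Edge L // e ∈ A} → G :=
  fun e => f (src e.1) * a e * (f (tgt e.1))⁻¹

/-- The unitary on the Hilbert space of the edges in `A` implementing the gauge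
transformation `∏_v A^A_v(f v)` restricted to `A`. -/
def gaugeOpOn (G : Type) [Group G] (L : ℕ) (A : Set (Edge L)) (f : Vtx L → G) :
    (({e : Edge L // e ∈ A} → G) → ℂ) →ₗ[ℂ] (({e : Edge L // e ∈ A} → G) → ℂ) :=
  LinearMap.funLeft ℂ ℂ (gaugeAllOn A fun v => (f v)⁻¹)

/-- `P_A` (resp. `P_Ā`): the product of the projectors `A_v` over the vertices
in `I` (the vertices strictly interior to the region), realized as the average
over all gauge transformations supported on `I`. -/
noncomputable def prodAvOn (G : Type) [Group G] [Fintype G] (L : ℕ) [NeZero L]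
    (A : Set (Edge L)) (I : Set (Vtx L)) :
    (({e : Edge L // e ∈ A} → G) → ℂ) →ₗ[ℂ] (({e : Edge L // e ∈ A} → G) → ℂ) :=
  ((Fintype.card G : ℂ) ^ (Nat.card I))⁻¹ •
    ∑ f : {v : Vtx L // v ∈ I} → G, gaugeOpOn G L A (extendV I f)

/-- Normalize a vector with respect to the standard inner product. -/
noncomputable def normalize {α : Type} [Fintype α] (ψ : α → ℂ) : α → ℂ :=
  (((Real.sqrt (finner ψ ψ).re : ℝ) : ℂ))⁻¹ • ψ

/-- The normalized state
`|φ(g⃗)⟩ ∝ ∏_{v ∈ ∂} A^A_v(b v) · P_A |1⃗⟩` on the edges in `A`, where `I` is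
the set of interior vertices, `Bv` the set of boundary vertices, and `b` the
assignment of group elements to the boundary vertices. -/
noncomputable def phiState (G : Type) [Group G] [Fintype G] (L : ℕ) [NeZero L]
    (A : Set (Edge L)) (I : Set (Vtx L)) (Bv : Set (Vtx L)) (b : Vtx L → G) :
    ({e : Edge L // e ∈ A} → G) → ℂ :=
  normalize
    ((gaugeOpOn G L A fun v => if v ∈ Bv then b v else 1)
      (prodAvOn G L A I (deltaF fun _ => (1 : G))))

/-- The pure-gauge configuration obtained from the all-identity configuration
by the gauge transformation `f`. -/
def pureGauge {G : Type} [Group G] {L : ℕ} (f : Vtx L → G) : Config G L :=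
  fun e => f (src e) * (f (tgt e))⁻¹

/-- The trivial ground state `|ψ₀⟩ ∝ ∏_v A_v |1⃗⟩` of the quantum double
model. -/
noncomputable def psi0 (G : Type) [Group G] [Fintype G] (L : ℕ) [NeZero L] :
    H G L :=
  normalize (∑ f : Vtx L → G, deltaF (pureGauge f))

/-- Pure gauge configuration on the edges in `A`. -/
def pgOn {G : Type} [Group G] {L : ℕ} (A : Set (Edge L)) (F : Vtx L → G) :
    {e : Edge L // e ∈ A} → G :=
  fun e => F (src e.1) * (F (tgt e.1))⁻¹

/-- Combinatorial properties of a region. -/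
structure Good (G : Type) [Group G] {L : ℕ} (A : Set (Edge L)) (I B : Set (Vtx L))
    (c : Vtx L) : Prop where
  disj : ∀ v ∈ I, v ∉ B
  ends : ∀ e ∈ A, (src e ∈ I ∨ src e ∈ B) ∧ (tgt e ∈ I ∨ tgt e ∈ B)
  conn : ∀ k : Vtx L → G, (∀ e ∈ A, k (src e) = k (tgt e)) → ∀ v, v ∈ I ∨ v ∈ B → k v = k c
  hc : c ∈ B

/-- Indicator of a proposition. -/
def ind (P : Prop) : ℂ := if P then 1 else 0

lemma ind_pos {P : Prop} (h : P) : ind P = 1 := by unfold ind; rw [if_pos h]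

lemma ind_neg {P : Prop} (h : ¬ P) : ind P = 0 := by unfold ind; rw [if_neg h]

lemma ind_congr {P Q : Prop} (h : P ↔ Q) : ind P = ind Q := by rw [propext h]

lemma conj_ind (P : Prop) : (starRingEnd ℂ) (ind P) = ind P := by
  unfold ind; split_ifs <;> simp

lemma ind_mul (P Q : Prop) : ind P * ind Q = ind (P ∧ Q) := by
  by_cases hP : P <;> by_cases hQ : Q <;> simp [ind, hP, hQ]

lemma sum_ind {X : Type} [Fintype X] (P : X → Prop) :
    ∑ x : X, ind (P x) = ((Finset.univ.filter P).card : ℂ) := by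
  unfold ind; rw [Finset.sum_boole]

lemma normalize_fib {T X : Type} [Fintype T] [Fintype X] [Nonempty T] (p : T → X) (m : ℕ)
    (hm : 0 < m)
    (hfib : ∀ t, (Finset.univ.filter (fun s => p s = p t)).card = m) (r : ℝ) (hr : 0 < r)
    (ψ : X → ℂ) (hψ : ψ = fun x => (r : ℂ) * ∑ t : T, ind (p t = x)) :
    normalize ψ = fun x => ((Real.sqrt ((Fintype.card T : ℝ) / m) : ℝ) : ℂ)⁻¹ *
      ind (∃ t, p t = x) := by
  have hN : ∀ x, (∑ t : T, ind (p t = x)) = m * ind (∃ t, p t = x) := by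
    intro x
    by_cases hx : ∃ t, p t = x
    · rw [ind_pos hx]
      obtain ⟨t, rfl⟩ := hx
      rw [sum_ind, hfib t, mul_one]
    · rw [ind_neg hx]
      push Not at hx
      simp [ind, hx]
  have hcard : (m : ℂ) * ∑ x : X, ind (∃ t, p t = x) = Fintype.card T := by
    rw [Finset.mul_sum]
    simp_rw [← hN]
    rw [Finset.sum_comm]
    simp [ind]
  have hψ' : ψ = fun x => (((r * m : ℝ)) : ℂ) * ind (∃ t, p t = x) := by
    rw [hψ]; funext x
    rw [hN]; push_cast; ring
  have hm' : (0:ℝ) < m := by exact_mod_cast hm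
  have h3 : (m : ℂ) ≠ 0 := by exact_mod_cast hm.ne'
  have hin : (finner ψ ψ).re = (r * m) ^ 2 * ((Fintype.card T : ℝ) / m) := by
    have : finner ψ ψ = (((r * m) ^ 2 * ((Fintype.card T : ℝ) / m) : ℝ) : ℂ) := by
      push_cast
      rw [← hcard, mul_div_cancel_left₀ _ h3, hψ', finner, Finset.mul_sum]
      refine Finset.sum_congr rfl fun x _ => ?_
      rw [map_mul, Complex.conj_ofReal, conj_ind]
      have := ind_mul (∃ t, p t = x) (∃ t, p t = x)
      rw [and_self] at this
      push_cast
      linear_combination ((r : ℂ) * m) ^ 2 * this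
    rw [this, Complex.ofReal_re]
  have hT : (0:ℝ) < Fintype.card T := by exact_mod_cast Fintype.card_pos
  have hs : (0:ℝ) < Real.sqrt ((Fintype.card T : ℝ) / m) := Real.sqrt_pos.2 (by positivity)
  funext x
  rw [normalize, hin, Real.sqrt_mul (by positivity), Real.sqrt_sq (by positivity)]
  rw [Pi.smul_apply, hψ', smul_eq_mul]
  have h1 : ((Real.sqrt ((Fintype.card T : ℝ) / m) : ℝ) : ℂ) ≠ 0 := by exact_mod_cast hs.ne'
  have h2 : (r : ℂ) ≠ 0 := by exact_mod_cast hr.ne'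
  push_cast
  field_simp

set_option linter.unusedSectionVars false

section
variable {G : Type} [Group G] [Fintype G] {L : ℕ} [NeZero L] {A : Set (Edge L)}
  {I B : Set (Vtx L)} {c : Vtx L}

lemma pgOn_const (hg : Good G A I B c) {F F' : Vtx L → G} (h : pgOn A F = pgOn A F')
    (v : Vtx L) (hv : v ∈ I ∨ v ∈ B) : (F' v)⁻¹ * F v = (F' c)⁻¹ * F c := by
  refine hg.conn (fun v => (F' v)⁻¹ * F v) (fun e he => ?_) v hv
  have := congrFun h ⟨e, he⟩
  simp only [pgOn] at this
  rw [mul_inv_eq_iff_eq_mul] at this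
  simp only [this]
  group

lemma pgOn_congr (hg : Good G A I B c) {F F' : Vtx L → G} (a : G)
    (h : ∀ v, v ∈ I ∨ v ∈ B → F v = F' v * a) : pgOn A F = pgOn A F' := by
  funext e
  simp only [pgOn]
  rw [h _ (hg.ends e.1 e.2).1, h _ (hg.ends e.1 e.2).2]
  group

/-- Glue boundary values and interior values. -/
def glueV (I : Set (Vtx L)) (b : Vtx L → G) (f : {v : Vtx L // v ∈ I} → G) : Vtx L → G :=
  fun v => if hv : v ∈ I then f ⟨v, hv⟩ else b v

lemma glue_in (b : Vtx L → G) (f : {v : Vtx L // v ∈ I} → G) (v : Vtx L) (hv : v ∈ I) :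
    glueV I b f v = f ⟨v, hv⟩ := by simp [glueV, hv]

lemma glue_out (b : Vtx L → G) (f : {v : Vtx L // v ∈ I} → G) (v : Vtx L) (hv : v ∉ I) :
    glueV I b f v = b v := by simp [glueV, hv]

lemma glue_inj (hg : Good G A I B c) (b : Vtx L → G) :
    Function.Injective (fun f : {v : Vtx L // v ∈ I} → G => pgOn A (glueV I b f)) := by
  intro f f' h
  have hcI : c ∉ I := fun hc => hg.disj c hc hg.hc
  funext v
  have := pgOn_const hg h v.1 (Or.inl v.2)
  rw [glue_out _ _ c hcI, glue_out _ _ c hcI, glue_in _ _ v.1 v.2, glue_in _ _ v.1 v.2,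
    inv_mul_cancel, inv_mul_eq_one] at this
  exact this.symm

lemma exists_glue (hg : Good G A I B c) (b : Vtx L → G) (x : {e : Edge L // e ∈ A} → G) :
    (∃ f : {v : Vtx L // v ∈ I} → G, pgOn A (glueV I b f) = x) ↔
      ∃ F : Vtx L → G, (∀ v ∈ B, F v = b v) ∧ pgOn A F = x := by
  constructor
  · rintro ⟨f, rfl⟩
    exact ⟨_, fun v hv => glue_out _ _ v fun h => hg.disj v h hv, rfl⟩
  · rintro ⟨F, hF, rfl⟩
    refine ⟨fun v => F v.1, pgOn_congr hg 1 ?_⟩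
    intro v hv
    rw [mul_one]
    by_cases h : v ∈ I
    · rw [glue_in _ _ v h]
    · rw [glue_out _ _ v h, hF v (hv.resolve_left h)]

lemma phi_eq (hg : Good G A I B c) (b : Vtx L → G) :
    phiState G L A I B b = fun x =>
      ((Real.sqrt ((Fintype.card G : ℝ) ^ (Nat.card I)) : ℝ) : ℂ)⁻¹ *
        ind (∃ F : Vtx L → G, (∀ v ∈ B, F v = b v) ∧ pgOn A F = x) := by
  have hG : (0:ℝ) < Fintype.card G := by exact_mod_cast Fintype.card_pos
  rw [phiState, normalize_fib (fun f : {v : Vtx L // v ∈ I} → G => pgOn A (glueV I b f)) 1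
    one_pos ?_ (((Fintype.card G : ℝ) ^ (Nat.card I))⁻¹) (by positivity)]
  · funext x
    simp only [exists_glue hg]
    congr 4
    rw [Fintype.card_fun]
    simp [Nat.card_eq_fintype_card]
  · funext x
    simp only [gaugeOpOn, prodAvOn, LinearMap.funLeft_apply, LinearMap.smul_apply,
      LinearMap.sum_apply, Pi.smul_apply, Finset.sum_apply, smul_eq_mul, deltaF]
    push_cast
    congr 1
    refine Finset.sum_congr rfl fun f _ => ?_
    change ind _ = ind _
    apply ind_congr
    rw [funext_iff, funext_iff]
    refine forall_congr' fun e => ?_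
    have key : ∀ v, v ∈ I ∨ v ∈ B → glueV I b f v = (if v ∈ B then b v else 1) * extendV I f v := by
      intro v hv
      by_cases h : v ∈ I
      · simp [glueV, extendV, h, hg.disj v h]
      · simp [glueV, extendV, h, hv.resolve_left h]
    simp only [pgOn, gaugeAllOn]
    rw [key _ (hg.ends e.1 e.2).1, key _ (hg.ends e.1 e.2).2]
    generalize (if src e.1 ∈ B then b (src e.1) else 1) = p
    generalize (if tgt e.1 ∈ B then b (tgt e.1) else 1) = q
    generalize extendV I f (src e.1) = s
    generalize extendV I f (tgt e.1) = t
    generalize x e = y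
    constructor
    · intro h
      have : y = p * s * t⁻¹ * q⁻¹ := by
        have h' : y = p * s * (s⁻¹ * (p⁻¹ * y * q⁻¹⁻¹) * t⁻¹⁻¹) * t⁻¹ * q⁻¹ := by group
        rw [h', h]; group
      rw [this]; group
    · rintro rfl; group
  · intro f
    rw [Finset.card_eq_one]
    refine ⟨f, ?_⟩
    ext f'
    simp only [Finset.mem_filter, Finset.mem_univ, true_and, Finset.mem_singleton]
    exact (glue_inj hg b).eq_iff

lemma phi_same (hg : Good G A I B c) (b b' : Vtx L → G)
    (h : ∃ a : G, ∀ v ∈ B, b v = b' v * a) :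
    phiState G L A I B b = phiState G L A I B b' := by
  obtain ⟨a, ha⟩ := h
  rw [phi_eq hg, phi_eq hg]
  funext x
  congr 1
  apply ind_congr
  constructor
  · rintro ⟨F, hF, rfl⟩
    refine ⟨fun v => F v * a⁻¹, fun v hv => by simp [hF v hv, ha v hv],
      pgOn_congr hg a⁻¹ fun v _ => rfl⟩
  · rintro ⟨F, hF, rfl⟩
    refine ⟨fun v => F v * a, fun v hv => by simp [hF v hv, ha v hv],
      pgOn_congr hg a fun v _ => rfl⟩

lemma phi_orth (hg : Good G A I B c) (b b' : Vtx L → G)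
    (h : ¬ ∃ a : G, ∀ v ∈ B, b v = b' v * a) :
    finner (phiState G L A I B b') (phiState G L A I B b) = 0 := by
  rw [phi_eq hg, phi_eq hg, finner]
  refine Finset.sum_eq_zero fun x _ => ?_
  by_cases h1 : ∃ F : Vtx L → G, (∀ v ∈ B, F v = b v) ∧ pgOn A F = x
  · by_cases h2 : ∃ F : Vtx L → G, (∀ v ∈ B, F v = b' v) ∧ pgOn A F = x
    · exfalso
      obtain ⟨F, hF, rfl⟩ := h1
      obtain ⟨F', hF', hx⟩ := h2
      refine h ⟨(F' c)⁻¹ * F c, fun v hv => ?_⟩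
      have := pgOn_const hg hx.symm v (Or.inr hv)
      rw [← hF v hv, ← hF' v hv, ← this]; group
    · rw [ind_neg h2]; simp
  · rw [ind_neg h1]; simp

lemma psi0_eq (hall : Good G (Set.univ : Set (Edge L)) {c}ᶜ {c} c) :
    psi0 G L = fun x => ((Real.sqrt (((Fintype.card G ^ Fintype.card (Vtx L) : ℕ) : ℝ) /
      Fintype.card G) : ℝ) : ℂ)⁻¹ * ind (∃ F : Vtx L → G, pureGauge F = x) := by
  have hpg : ∀ F F' : Vtx L → G, pureGauge F = pureGauge F' ↔ ∃ a : G, F = fun v => F' v * a := by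
    intro F F'
    constructor
    · intro h
      refine ⟨(F' c)⁻¹ * F c, funext fun v => ?_⟩
      have := pgOn_const hall (F := F) (F' := F')
        (funext fun e => congrFun h e.1) v (by by_cases h : v = c <;> simp [h])
      rw [← this]; group
    · rintro ⟨a, rfl⟩
      funext e
      simp only [pureGauge]; group
  rw [psi0, normalize_fib (fun F : Vtx L → G => pureGauge F) (Fintype.card G)
    Fintype.card_pos ?_ 1 one_pos]
  · rw [Fintype.card_fun]
  · funext x
    simp only [deltaF, Finset.sum_apply, ind, Complex.ofReal_one, one_mul]
    refine Finset.sum_congr rfl fun t _ => ?_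
    change ind _ = ind _
    exact ind_congr eq_comm
  · intro F
    simp only [hpg]
    rw [← Finset.card_univ]
    symm
    refine Finset.card_bij (fun a _ => fun v => F v * a) ?_ ?_ ?_
    · intro a _; simp only [Finset.mem_filter, Finset.mem_univ, true_and]; exact ⟨a, rfl⟩
    · intro a _ a' _ h; simpa using congrFun h c
    · intro F' h
      simp only [Finset.mem_filter, Finset.mem_univ, true_and] at h
      obtain ⟨a, rfl⟩ := h
      exact ⟨a, Finset.mem_univ _, rfl⟩

lemma merge_eq_pure (a : {e : Edge L // e ∈ A} → G) (b : {e : Edge L // e ∉ A} → G)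
    (F : Vtx L → G) :
    pureGauge F = merge A a b ↔ pgOn A F = a ∧ pgOn Aᶜ F = b := by
  constructor
  · intro h
    constructor
    · funext e
      have := congrFun h e.1
      simpa [merge, pureGauge, e.2, pgOn] using this
    · funext e
      have := congrFun h e.1
      have he : e.1 ∉ A := e.2
      simpa [merge, pureGauge, he, pgOn] using this
  · rintro ⟨rfl, rfl⟩
    funext e
    by_cases he : e ∈ A <;> simp [merge, pureGauge, he, pgOn]

lemma rho_eq {O : Set (Vtx L)} (hg : Good G A I B c) (hg' : Good G Aᶜ O B c)
    (hall : Good G (Set.univ : Set (Edge L)) {c}ᶜ {c} c)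
    (hdis : ∀ v ∈ I, v ∉ O) (hcov : ∀ v, v ∈ I ∨ v ∈ B ∨ v ∈ O) (l : ℕ)
    (hl : Nat.card B = l + 1) :
    rho A (psi0 G L) =
      ((Fintype.card G : ℂ) ^ l)⁻¹ •
        ∑ b : {b : Vtx L → G // (∀ v : Vtx L, v ∉ B → b v = 1) ∧ b c = 1},
          Matrix.of fun a a' =>
            phiState G L A I B b.1 a * (starRingEnd ℂ) (phiState G L A I B b.1 a') := by
  have hG : (0:ℝ) < Fintype.card G := by exact_mod_cast Fintype.card_pos
  have hGC : (Fintype.card G : ℂ) ≠ 0 := by exact_mod_cast hG.ne'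
  have hcardV : Fintype.card (Vtx L) = Nat.card I + (l + 1) + Nat.card O := by
    have e1 : (Set.univ : Set (Vtx L)) = (I ∪ B) ∪ O := by
      ext v; have := hcov v; simp; tauto
    have d1 : Disjoint (I ∪ B) O := by
      rw [Set.disjoint_left]
      rintro v (hv | hv) ho
      · exact hdis v hv ho
      · exact hg'.disj v ho hv
    have d2 : Disjoint I B := Set.disjoint_left.2 hg.disj
    rw [← Nat.card_eq_fintype_card, ← Set.ncard_univ, e1, Set.ncard_union_eq d1,
      Set.ncard_union_eq d2, ← hl]
    rfl
  have hsq : ∀ r : ℝ, 0 ≤ r → (((Real.sqrt r : ℝ) : ℂ)⁻¹ * ((Real.sqrt r : ℝ) : ℂ)⁻¹) = (r : ℂ)⁻¹ := by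
    intro r hr
    rw [← mul_inv, ← Complex.ofReal_mul, Real.mul_self_sqrt hr]
  have hmulif : ∀ (P Q : Prop) (r : ℝ), (((r : ℝ) : ℂ)⁻¹ * ind P) *
      (starRingEnd ℂ) (((r : ℝ) : ℂ)⁻¹ * ind Q) = (((r : ℝ) : ℂ)⁻¹ * ((r : ℝ) : ℂ)⁻¹) * ind (P ∧ Q) := by
    intro P Q r
    rw [map_mul, map_inv₀, Complex.conj_ofReal, conj_ind, ← ind_mul]
    ring
  have hcO : c ∉ O := fun h => hg'.disj c h hg.hc
  have hcI : c ∉ I := fun h => hg.disj c h hg.hc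
  ext a a'
  rw [rho, Matrix.of_apply, Matrix.smul_apply, Matrix.sum_apply]
  simp only [Matrix.of_apply, psi0_eq hall, phi_eq hg, hmulif]
  rw [← Finset.mul_sum, ← Finset.mul_sum, hsq _ (by positivity), hsq _ (by positivity), smul_eq_mul]
  -- normal form of a pure-gauge configuration
  have hnorm : ∀ x : Config G L, (∃ F : Vtx L → G, pureGauge F = x) →
      ∃ F : Vtx L → G, F c = 1 ∧ pureGauge F = x := by
    rintro x ⟨F, rfl⟩
    refine ⟨fun v => F v * (F c)⁻¹, by simp, ?_⟩
    funext e; simp [pureGauge]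
  by_cases hgood : ∃ F F' : Vtx L → G, F c = 1 ∧ F' c = 1 ∧ (∀ v ∈ B, F v = F' v) ∧
      pgOn A F = a ∧ pgOn A F' = a'
  · obtain ⟨F, F', hFc, hFc', hFF, hFa, hFa'⟩ := hgood
    have hR : (∑ b : {b : Vtx L → G // (∀ v : Vtx L, v ∉ B → b v = 1) ∧ b c = 1},
        ind ((∃ E : Vtx L → G, (∀ v ∈ B, E v = b.1 v) ∧ pgOn A E = a) ∧
          (∃ E : Vtx L → G, (∀ v ∈ B, E v = b.1 v) ∧ pgOn A E = a'))) = 1 := by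
      rw [Finset.sum_eq_single ⟨fun v => if v ∈ B then F v else 1,
        fun v hv => by simp [hv], by simp [hFc]⟩]
      · refine ind_pos ?_
        refine ⟨⟨F, fun v hv => by simp [hv], hFa⟩, ⟨F', fun v hv => by simp [hv, hFF v hv], hFa'⟩⟩
      · rintro ⟨b, hb1, hbc⟩ _ hne
        refine ind_neg ?_
        rintro ⟨⟨E, hE, hEa⟩, -⟩
        replace hE : ∀ v ∈ B, E v = b v := hE
        apply hne
        rw [Subtype.mk.injEq]
        funext v
        by_cases hv : v ∈ B
        · have := pgOn_const hg (hEa.trans hFa.symm) v (Or.inr hv)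
          rw [hE c hg.hc, hbc, hFc, hE v hv] at this
          simp only [inv_one, mul_one, inv_mul_eq_one] at this
          simp [hv, this]
        · simp [hv, hb1 v hv]
      · simp
    have hLc : (∑ b : {e : Edge L // e ∉ A} → G,
        ind ((∃ E : Vtx L → G, pureGauge E = merge A a b) ∧
          (∃ E : Vtx L → G, pureGauge E = merge A a' b))) =
        (Fintype.card G : ℂ) ^ Nat.card O := by
      rw [sum_ind]
      rw [Nat.card_eq_fintype_card, ← Nat.cast_pow]
      congr 1
      have : Fintype.card G ^ Fintype.card O = Fintype.card ({v : Vtx L // v ∈ O} → G) := by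
        rw [Fintype.card_fun]
      rw [this, ← Finset.card_univ]
      symm
      refine Finset.card_bij (fun f _ => (pgOn Aᶜ (glueV O F f) : {e : Edge L // e ∉ A} → G)) ?_ ?_ ?_
      · intro f _
        simp only [Finset.mem_filter, Finset.mem_univ, true_and]
        refine ⟨⟨glueV O F f, (merge_eq_pure _ _ _).2 ⟨?_, rfl⟩⟩,
          ⟨glueV O F' f, (merge_eq_pure _ _ _).2 ⟨?_, ?_⟩⟩⟩
        · rw [← hFa]
          refine pgOn_congr hg 1 fun v hv => ?_
          rw [mul_one, glue_out]
          rcases hv with hv | hv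
          · exact hdis v hv
          · exact fun h => hg'.disj v h hv
        · rw [← hFa']
          refine pgOn_congr hg 1 fun v hv => ?_
          rw [mul_one, glue_out]
          rcases hv with hv | hv
          · exact hdis v hv
          · exact fun h => hg'.disj v h hv
        · refine pgOn_congr hg' 1 fun v hv => ?_
          rw [mul_one]
          by_cases ho : v ∈ O
          · rw [glue_in _ _ v ho, glue_in _ _ v ho]
          · rw [glue_out _ _ v ho, glue_out _ _ v ho, hFF v (hv.resolve_left ho)]
      · intro f _ f' _ h
        exact glue_inj hg' F h
      · intro y hy
        simp only [Finset.mem_filter, Finset.mem_univ, true_and] at hy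
        obtain ⟨E, hEc, hE⟩ := hnorm _ hy.1
        obtain ⟨hEa, hEy⟩ := (merge_eq_pure _ _ _).1 hE
        refine ⟨fun v => E v.1, Finset.mem_univ _, ?_⟩
        rw [← hEy]
        refine pgOn_congr hg' 1 fun v hv => ?_
        rw [mul_one]
        by_cases ho : v ∈ O
        · rw [glue_in _ _ v ho]
        · rw [glue_out _ _ v ho]
          have := pgOn_const hg (hEa.trans hFa.symm) v (Or.inr (hv.resolve_left ho))
          rw [hEc, hFc] at this
          simpa [inv_mul_eq_one] using this
    rw [hR, hLc, hcardV]
    push_cast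
    rw [pow_add, pow_add, pow_succ]
    field_simp
  · have hR : ∀ b : {b : Vtx L → G // (∀ v : Vtx L, v ∉ B → b v = 1) ∧ b c = 1},
        ¬ ((∃ E : Vtx L → G, (∀ v ∈ B, E v = b.1 v) ∧ pgOn A E = a) ∧
          (∃ E : Vtx L → G, (∀ v ∈ B, E v = b.1 v) ∧ pgOn A E = a')) := by
      rintro ⟨b, hb1, hbc⟩ ⟨⟨E, hE, hEa⟩, ⟨E', hE', hEa'⟩⟩
      replace hE : ∀ v ∈ B, E v = b v := hE
      replace hE' : ∀ v ∈ B, E' v = b v := hE'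
      exact hgood ⟨E, E', by rw [hE c hg.hc, hbc], by rw [hE' c hg.hc, hbc],
        fun v hv => by rw [hE v hv, hE' v hv], hEa, hEa'⟩
    have hL : ∀ b : {e : Edge L // e ∉ A} → G,
        ¬ ((∃ E : Vtx L → G, pureGauge E = merge A a b) ∧
          (∃ E : Vtx L → G, pureGauge E = merge A a' b)) := by
      rintro b ⟨h1, h2⟩
      obtain ⟨E, hEc, hE⟩ := hnorm _ h1
      obtain ⟨E', hEc', hE'⟩ := hnorm _ h2
      rw [merge_eq_pure] at hE hE'
      refine hgood ⟨E, E', hEc, hEc', fun v hv => ?_, hE.1, hE'.1⟩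
      have := pgOn_const hg' (hE.2.trans hE'.2.symm) v (Or.inr hv)
      rw [hEc, hEc'] at this
      simp only [inv_one, mul_one, inv_mul_eq_one] at this
      exact this.symm
    simp only [fun b => ind_neg (hR b), fun b => ind_neg (hL b), Finset.sum_const_zero, mul_zero]

end

/-! ### Geometry of the rectangle -/

section
variable {L : ℕ} [NeZero L]

/-- The vertex with coordinates `(i, j)` relative to `c`. -/
def pt (c : Vtx L) (i j : ℕ) : Vtx L := c + ((i : ZMod L), (j : ZMod L))

lemma cast_inj' {i j : ℕ} (hi : i < L) (hj : j < L) (h : (i : ZMod L) = j) : i = j := by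
  rw [ZMod.natCast_eq_natCast_iff'] at h
  rwa [Nat.mod_eq_of_lt hi, Nat.mod_eq_of_lt hj] at h

lemma pt_inj {c : Vtx L} {i j i' j' : ℕ} (hi : i < L) (hj : j < L) (hi' : i' < L) (hj' : j' < L)
    (h : pt c i j = pt c i' j') : i = i' ∧ j = j' := by
  have := add_left_cancel h
  rw [Prod.mk.injEq] at this
  exact ⟨cast_inj' hi hi' this.1, cast_inj' hj hj' this.2⟩

lemma exists_pt (c v : Vtx L) : ∃ i j : ℕ, i < L ∧ j < L ∧ v = pt c i j := by
  refine ⟨(v.1 - c.1).val, (v.2 - c.2).val, ZMod.val_lt _, ZMod.val_lt _, ?_⟩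
  ext <;> simp [pt]

lemma pt_zero (c : Vtx L) : pt c 0 0 = c := by ext <;> simp [pt]

lemma pt_right (c : Vtx L) (i j : ℕ) : pt c i j + (1, 0) = pt c (i + 1) j := by
  ext <;> simp [pt, add_assoc]

lemma pt_up (c : Vtx L) (i j : ℕ) : pt c i j + (0, 1) = pt c i (j + 1) := by
  ext <;> simp [pt, add_assoc]

lemma pt_L_left (c : Vtx L) (j : ℕ) : pt c L j = pt c 0 j := by ext <;> simp [pt]

lemma pt_L_right (c : Vtx L) (i : ℕ) : pt c i L = pt c i 0 := by ext <;> simp [pt]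

lemma step_right {α : Type} {A : Set (Edge L)} {k : Vtx L → α}
    (hk : ∀ e ∈ A, k (src e) = k (tgt e)) {c : Vtx L}
    {i j : ℕ} (h : (pt c i j, false) ∈ A) : k (pt c i j) = k (pt c (i + 1) j) := by
  have := hk _ h
  simpa [src, tgt, pt_right] using this

lemma step_up {α : Type} {A : Set (Edge L)} {k : Vtx L → α}
    (hk : ∀ e ∈ A, k (src e) = k (tgt e)) {c : Vtx L}
    {i j : ℕ} (h : (pt c i j, true) ∈ A) : k (pt c i j) = k (pt c i (j + 1)) := by
  have := hk _ h
  simpa [src, tgt, pt_up] using this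

lemma conn_rect {α : Type} {c : Vtx L} {w h : ℕ} {k : Vtx L → α}
    (hk : ∀ e ∈ rectEdges L c w h, k (src e) = k (tgt e)) :
    ∀ i j : ℕ, i ≤ w → j ≤ h → k (pt c i j) = k c := by
  have h0 : ∀ i, i ≤ w → k (pt c i 0) = k c := by
    intro i
    induction i with
    | zero => intro _; rw [pt_zero]
    | succ n ih =>
      intro hn
      rw [← ih (by omega)]
      exact (step_right hk ⟨n, 0, rfl, by simp; omega⟩).symm
  intro i j hi
  induction j with
  | zero => intro _; exact h0 i hi
  | succ n ih =>
    intro hn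
    rw [← ih (by omega)]
    exact (step_up hk ⟨i, n, rfl, by simp; omega⟩).symm

lemma good_univ (G : Type) [Group G] (c : Vtx L) :
    Good G (Set.univ : Set (Edge L)) {c}ᶜ {c} c := by
  refine ⟨fun v hv => hv, fun e _ => ⟨?_, ?_⟩, fun k hk v _ => ?_, rfl⟩
  · by_cases h : src e = c <;> simp [h]
  · by_cases h : tgt e = c <;> simp [h]
  · obtain ⟨i, j, -, -, rfl⟩ := exists_pt c v
    exact conn_rect (w := i) (h := j) (fun e _ => hk e trivial) i j le_rfl le_rfl

variable {c : Vtx L} {w h : ℕ}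

lemma not_int_bdry (hwL : w + 1 < L) (hhL : h + 1 < L) (v : Vtx L) (hv : v ∈ rectIntVtx L c w h) :
    v ∉ rectBdryVtx L c w h := by
  obtain ⟨i, j, h1, h2, h3, h4, rfl⟩ := hv
  rintro ⟨i', j', h1', h2', h3', he⟩
  obtain ⟨rfl, rfl⟩ := pt_inj (c := c) (by omega) (by omega) (by omega) (by omega) he
  omega

lemma int_or_bdry (v : Vtx L) (hv : v ∈ rectVtx L c w h) :
    v ∈ rectIntVtx L c w h ∨ v ∈ rectBdryVtx L c w h := by
  obtain ⟨i, j, h1, h2, rfl⟩ := hv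
  by_cases hh : i = 0 ∨ i = w ∨ j = 0 ∨ j = h
  · exact Or.inr ⟨i, j, h1, h2, hh, rfl⟩
  · exact Or.inl ⟨i, j, by omega, by omega, by omega, by omega, rfl⟩

lemma int_sub (v : Vtx L) (hv : v ∈ rectIntVtx L c w h) : v ∈ rectVtx L c w h := by
  obtain ⟨i, j, h1, h2, h3, h4, rfl⟩ := hv
  exact ⟨i, j, by omega, by omega, rfl⟩

lemma bdry_sub (v : Vtx L) (hv : v ∈ rectBdryVtx L c w h) : v ∈ rectVtx L c w h := by
  obtain ⟨i, j, h1, h2, h3, rfl⟩ := hv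
  exact ⟨i, j, by omega, by omega, rfl⟩

lemma c_bdry : c ∈ rectBdryVtx L c w h :=
  ⟨0, 0, by omega, by omega, by omega, (pt_zero c).symm⟩

lemma good_in (G : Type) [Group G] (hwL : w + 1 < L) (hhL : h + 1 < L) :
    Good G (rectEdges L c w h) (rectIntVtx L c w h) (rectBdryVtx L c w h) c := by
  refine ⟨not_int_bdry hwL hhL, ?_, fun k hk v hv => ?_, c_bdry⟩
  · rintro ⟨v, d⟩ ⟨i, j, hv, hd⟩
    replace hv : v = pt c i j := hv
    subst hv
    constructor <;> apply int_or_bdry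
    · refine ⟨i, j, ?_, ?_, rfl⟩ <;> cases d <;> simp at hd <;> omega
    · cases d <;> simp at hd
      · exact ⟨i + 1, j, by omega, by omega, by simpa [tgt, pt] using pt_right c i j⟩
      · exact ⟨i, j + 1, by omega, by omega, by simpa [tgt, pt] using pt_up c i j⟩
  · have : v ∈ rectVtx L c w h := hv.elim (int_sub v) (bdry_sub v)
    obtain ⟨i, j, h1, h2, rfl⟩ := this
    exact conn_rect hk i j h1 h2

lemma not_mem_edges (hwL : w + 1 < L) (hhL : h + 1 < L) {i j : ℕ} (hi : i < L) (hj : j < L)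
    (d : Bool) (hd : ¬ if d then i ≤ w ∧ j < h else i < w ∧ j ≤ h) :
    (pt c i j, d) ∈ (rectEdges L c w h)ᶜ := by
  rintro ⟨i', j', he, hd'⟩
  replace he : pt c i j = pt c i' j' := he
  have hb : i' ≤ w ∧ j' ≤ h := by cases d <;> simp at hd' <;> omega
  obtain ⟨rfl, rfl⟩ := pt_inj hi hj (by omega) (by omega) he
  exact hd hd'

lemma good_out (G : Type) [Group G] (hwL : w + 1 < L) (hhL : h + 1 < L) :
    Good G (rectEdges L c w h)ᶜ (rectVtx L c w h)ᶜ (rectBdryVtx L c w h) c := by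
  refine ⟨fun v hv hb => hv (bdry_sub v hb), ?_, fun k hk => ?_, c_bdry⟩
  · rintro ⟨v, d⟩ he
    have hcase : ∀ u, u ∉ rectIntVtx L c w h →
        u ∈ (rectVtx L c w h)ᶜ ∨ u ∈ rectBdryVtx L c w h := by
      intro u hu
      by_cases hu' : u ∈ rectVtx L c w h
      · exact Or.inr ((int_or_bdry u hu').resolve_left hu)
      · exact Or.inl hu'
    constructor <;> apply hcase
    · rintro ⟨i, j, h1, h2, h3, h4, hv⟩
      exact he ⟨i, j, hv, by cases d <;> simp <;> omega⟩
    · rintro ⟨i, j, h1, h2, h3, h4, hv⟩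
      cases d
      · obtain ⟨n, rfl⟩ : ∃ n, i = n + 1 := ⟨i - 1, by omega⟩
        refine he ⟨n, j, ?_, by simp; omega⟩
        replace hv : v + (1, 0) = pt c (n + 1) j := by simpa [tgt, pt] using hv
        rw [← pt_right] at hv
        exact add_right_cancel hv
      · obtain ⟨n, rfl⟩ : ∃ n, j = n + 1 := ⟨j - 1, by omega⟩
        refine he ⟨i, n, ?_, by simp; omega⟩
        replace hv : v + (0, 1) = pt c i (n + 1) := by simpa [tgt, pt] using hv
        rw [← pt_up] at hv
        exact add_right_cancel hv
  · have sH : ∀ i j, i < L → j < L → (w ≤ i ∨ h < j) → k (pt c i j) = k (pt c (i + 1) j) :=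
      fun i j hi hj hd => step_right hk (not_mem_edges hwL hhL hi hj false (by simp; omega))
    have sV : ∀ i j, i < L → j < L → (h ≤ j ∨ w < i) → k (pt c i j) = k (pt c i (j + 1)) :=
      fun i j hi hj hd => step_up hk (not_mem_edges hwL hhL hi hj true (by simp; omega))
    have cH : ∀ n i j, i + n < L → j < L → (w ≤ i ∨ h < j) →
        k (pt c i j) = k (pt c (i + n) j) := by
      intro n
      induction n with
      | zero => intros; rfl
      | succ n ih =>
        intro i j hi hj hd
        rw [ih i j (by omega) hj hd, sH (i + n) j (by omega) hj (by omega)]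
        rfl
    have cV : ∀ n i j, i < L → j + n < L → (h ≤ j ∨ w < i) →
        k (pt c i j) = k (pt c i (j + n)) := by
      intro n
      induction n with
      | zero => intros; rfl
      | succ n ih =>
        intro i j hi hj hd
        rw [ih i j hi (by omega) hd, sV i (j + n) hi (by omega) (by omega)]
        rfl
    have H : ∀ i j, i < L → j < L → (w ≤ i ∨ h < j) → k (pt c i j) = k (pt c (L - 1) j) := by
      intro i j hi hj hd
      rw [cH (L - 1 - i) i j (by omega) hj hd]
      congr 2; omega
    have V : ∀ i j, i < L → j < L → (h ≤ j ∨ w < i) → k (pt c i j) = k (pt c i (L - 1)) := by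
      intro i j hi hj hd
      rw [cV (L - 1 - j) i j hi (by omega) hd]
      congr 2; omega
    have P : ∀ i j, i < L → j < L → (w ≤ i ∨ h ≤ j) →
        k (pt c i j) = k (pt c (L - 1) (L - 1)) := by
      intro i j hi hj hd
      rcases hd with hd | hd
      · rw [H i j hi hj (by omega), V (L - 1) j (by omega) hj (by omega)]
      · rw [V i j hi hj (by omega), H i (L - 1) hi (by omega) (by omega)]
    have hL1 : L - 1 + 1 = L := by omega
    have Q : ∀ i j, i < L → j < L → (w ≤ i ∨ h ≤ j ∨ i = 0 ∨ j = 0) →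
        k (pt c i j) = k (pt c (L - 1) (L - 1)) := by
      intro i j hi hj hd
      rcases hd with hd | hd | rfl | rfl
      · exact P i j hi hj (Or.inl hd)
      · exact P i j hi hj (Or.inr hd)
      · rw [← P (L - 1) j (by omega) hj (by omega), sH (L - 1) j (by omega) hj (by omega), hL1,
          pt_L_left]
      · rw [← P i (L - 1) hi (by omega) (by omega), sV i (L - 1) hi (by omega) (by omega), hL1,
          pt_L_right]
    have hcc : k c = k (pt c (L - 1) (L - 1)) := by
      rw [← Q 0 0 (by omega) (by omega) (by omega), pt_zero]
    intro v hv
    rw [hcc]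
    rcases hv with hv | ⟨i, j, h1, h2, h3, rfl⟩
    · obtain ⟨i, j, hi, hj, rfl⟩ := exists_pt c v
      refine Q i j hi hj ?_
      by_contra hcon
      exact hv ⟨i, j, by omega, by omega, rfl⟩
    · exact Q i j (by omega) (by omega) (by omega)

lemma card_bdry (hw : 0 < w) (hwL : w + 1 < L) (hh : 0 < h) (hhL : h + 1 < L) :
    Nat.card (rectBdryVtx L c w h) = 2 * (w + h) - 1 + 1 := by
  let S : Finset (ℕ × ℕ) := (Finset.range (w + 1) ×ˢ Finset.range (h + 1)) \
    (Finset.Ioo 0 w ×ˢ Finset.Ioo 0 h)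
  have hS : rectBdryVtx L c w h = (fun p : ℕ × ℕ => pt c p.1 p.2) '' (S : Set (ℕ × ℕ)) := by
    ext v
    constructor
    · rintro ⟨i, j, h1, h2, h3, rfl⟩
      refine ⟨(i, j), ?_, rfl⟩
      simp [S]; omega
    · rintro ⟨⟨i, j⟩, hS, rfl⟩
      simp [S] at hS
      exact ⟨i, j, by omega, by omega, by omega, rfl⟩
  have hinj : Set.InjOn (fun p : ℕ × ℕ => pt c p.1 p.2) (S : Set (ℕ × ℕ)) := by
    rintro ⟨i, j⟩ h1 ⟨i', j'⟩ h2 he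
    simp [S] at h1 h2
    obtain ⟨rfl, rfl⟩ := pt_inj (by omega) (by omega) (by omega) (by omega) he
    rfl
  have hsub : Finset.Ioo 0 w ×ˢ Finset.Ioo 0 h ⊆ Finset.range (w + 1) ×ˢ Finset.range (h + 1) := by
    rintro ⟨i, j⟩ hp
    simp at hp ⊢; omega
  rw [Nat.card_coe_set_eq, hS, Set.InjOn.ncard_image hinj, Set.ncard_coe_finset,
    Finset.card_sdiff_of_subset hsub]
  simp only [Finset.card_product, Finset.card_range, Nat.card_Ioo]
  obtain ⟨w, rfl⟩ : ∃ n, w = n + 1 := ⟨w - 1, by omega⟩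
  obtain ⟨h, rfl⟩ : ∃ n, h = n + 1 := ⟨h - 1, by omega⟩
  have e1 : w + 1 - 0 - 1 = w := by omega
  have e2 : h + 1 - 0 - 1 = h := by omega
  rw [e1, e2]
  have : (w + 1 + 1) * (h + 1 + 1) = w * h + (2 * (w + 1 + (h + 1))) := by ring
  omega

end

/-- **The states `|φ_A(g⃗)⟩` and the reduced density matrix of the trivial
ground state (eqs. (40)–(44) of the paper).**  Let `A` be the `w × h` rectangle
with corner `c` (contained in a contractible subregion: `0 < w`, `w + 1 < L`,
`0 < h`, `h + 1 < L`), with interior vertices `I`, boundary vertices `∂A`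
(`|∂A| = 2(w+h) =: ℓ`), and complementary region `Ā` (with interior vertices
`V ∖ V(A)`).  For assignments `b, b' : V → G` of group elements to the boundary
vertices:

* if `b = b'·a` on `∂A` for a single `a ∈ G` then `|φ_A(b)⟩ = |φ_A(b')⟩`,
  and otherwise `⟨φ_A(b')|φ_A(b)⟩ = 0`;
* the same equality/orthogonality dichotomy holds for the states
  `|φ_Ā(b)⟩` on the complement;
* `Tr_{Ā}|ψ₀⟩⟨ψ₀| = |G|^{-(ℓ−1)} ∑_{b} |φ_A(b)⟩⟨φ_A(b)|`, the sum being over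
  the assignments `b` supported on `∂A` normalized by `b c = 1` at the corner
  (one representative per equivalence class `b ∼ b·a`). -/
theorem phi_states_and_reduced_ground_state
    (G : Type) [Group G] [Fintype G] (L : ℕ) [NeZero L] (c : Vtx L) (w h : ℕ)
    (hw : 0 < w) (hwL : w + 1 < L) (hh : 0 < h) (hhL : h + 1 < L) :
    (∀ b b' : Vtx L → G, (∃ a : G, ∀ v ∈ rectBdryVtx L c w h, b v = b' v * a) →
      phiState G L (rectEdges L c w h) (rectIntVtx L c w h) (rectBdryVtx L c w h) b =
        phiState G L (rectEdges L c w h) (rectIntVtx L c w h) (rectBdryVtx L c w h) b') ∧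
    (∀ b b' : Vtx L → G, (¬ ∃ a : G, ∀ v ∈ rectBdryVtx L c w h, b v = b' v * a) →
      finner
        (phiState G L (rectEdges L c w h) (rectIntVtx L c w h) (rectBdryVtx L c w h) b')
        (phiState G L (rectEdges L c w h) (rectIntVtx L c w h) (rectBdryVtx L c w h) b)
        = 0) ∧
    (∀ b b' : Vtx L → G, (∃ a : G, ∀ v ∈ rectBdryVtx L c w h, b v = b' v * a) →
      phiState G L (rectEdges L c w h)ᶜ (rectVtx L c w h)ᶜ (rectBdryVtx L c w h) b =
        phiState G L (rectEdges L c w h)ᶜ (rectVtx L c w h)ᶜ (rectBdryVtx L c w h) b') ∧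
    (∀ b b' : Vtx L → G, (¬ ∃ a : G, ∀ v ∈ rectBdryVtx L c w h, b v = b' v * a) →
      finner
        (phiState G L (rectEdges L c w h)ᶜ (rectVtx L c w h)ᶜ (rectBdryVtx L c w h) b')
        (phiState G L (rectEdges L c w h)ᶜ (rectVtx L c w h)ᶜ (rectBdryVtx L c w h) b)
        = 0) ∧
    rho (rectEdges L c w h) (psi0 G L) =
      ((Fintype.card G : ℂ) ^ (2 * (w + h) - 1))⁻¹ •
        ∑ b : {b : Vtx L → G //
            (∀ v : Vtx L, v ∉ rectBdryVtx L c w h → b v = 1) ∧ b c = 1},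
          Matrix.of fun a a' =>
            phiState G L (rectEdges L c w h) (rectIntVtx L c w h)
                (rectBdryVtx L c w h) b.1 a *
              (starRingEnd ℂ)
                (phiState G L (rectEdges L c w h) (rectIntVtx L c w h)
                  (rectBdryVtx L c w h) b.1 a') := by
  have hgi := good_in (c := c) G hwL hhL
  have hgo := good_out (c := c) G hwL hhL
  refine ⟨phi_same hgi, phi_orth hgi, phi_same hgo, fun b b' hb => ?_, ?_⟩
  · convert phi_orth hgo b b' hb
  refine rho_eq hgi hgo (good_univ G c) (fun v hv ho => ho (int_sub v hv)) (fun v => ?_) _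
    (card_bdry hw hwL hh hhL)
  by_cases hv : v ∈ rectVtx L c w h
  · rcases int_or_bdry v hv with h1 | h1
    · exact Or.inl h1
    · exact Or.inr (Or.inl h1)
  · exact Or.inr (Or.inr hv)

end QDM
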